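/- For any two projections p and q on a Hilbert space H, the projection onto the closure of the subspace pqH equals p − p ∧ (1−q). -/

import Mathlib

open scoped ComplexOrder

namespace Paper

variable {H : Type} [NormedAddCommGroup H] [InnerProductSpace ℂ H] [CompleteSpace H]

/-- `p` is an (orthogonal) projection operator. -/
def IsProj (p : H →L[ℂ] H) : Prop := IsIdempotentElem p ∧ IsSelfAdjoint p

/-- `p` is a projection belonging to the von Neumann algebra `M`. -/
def IsProjection (M : VonNeumannAlgebra H) (p : H →L[ℂ] H) : Prop :=
  p ∈ M ∧ IsProj p

/-- The range of an operator, as a submodule. -/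
def rng (p : H →L[ℂ] H) : Submodule ℂ H := LinearMap.range p.toLinearMap

/-- `r` is the lattice meet `p ∧ q` of projections: the orthogonal projection onto `pH ∩ qH`. -/
def IsMeetOf (r p q : H →L[ℂ] H) : Prop := IsProj r ∧ rng r = rng p ⊓ rng q

/-- `r` is the lattice join `p ∨ q` of projections:
the orthogonal projection onto the closure of `pH + qH`. -/
def IsJoinOf (r p q : H →L[ℂ] H) : Prop :=
  IsProj r ∧ rng r = (rng p ⊔ rng q).topologicalClosure

/-- A faithful tracial state on a von Neumann algebra, making it a finite von Neumann algebra. -/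
structure TracialState (M : VonNeumannAlgebra H) where
  τ : (H →L[ℂ] H) → ℂ
  map_add : ∀ a b : H →L[ℂ] H, τ (a + b) = τ a + τ b
  map_smul : ∀ (c : ℂ) (a : H →L[ℂ] H), τ (c • a) = c * τ a
  tracial : ∀ a b : H →L[ℂ] H, a ∈ M → b ∈ M → τ (a * b) = τ (b * a)
  pos : ∀ a : H →L[ℂ] H, a ∈ M → 0 ≤ τ (star a * a)
  faithful : ∀ a : H →L[ℂ] H, a ∈ M → τ (star a * a) = 0 → a = 0
  normalized : τ 1 = 1

/-- `M` is diffuse: it has no minimal nonzero projections. -/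
def Diffuse (M : VonNeumannAlgebra H) : Prop :=
  ∀ p : H →L[ℂ] H, IsProjection M p → p ≠ 0 →
    ∃ q : H →L[ℂ] H, IsProjection M q ∧ rng q ≤ rng p ∧ q ≠ 0 ∧ q ≠ p

end Paper

namespace Paper

variable {H : Type} [NormedAddCommGroup H] [InnerProductSpace ℂ H] [CompleteSpace H]

theorem IsProj.apply_apply {p : H →L[ℂ] H} (hp : IsProj p) (x : H) : p (p x) = p x :=
  DFunLike.congr_fun hp.1.eq x

theorem IsProj.one_sub {p : H →L[ℂ] H} (hp : IsProj p) : IsProj (1 - p) :=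
  ⟨hp.1.one_sub, (IsSelfAdjoint.one _).sub hp.2⟩

theorem IsProj.mem_rng_iff {p : H →L[ℂ] H} (hp : IsProj p) {x : H} : x ∈ rng p ↔ p x = x := by
  constructor
  · rintro ⟨y, rfl⟩
    exact hp.apply_apply y
  · exact fun h => ⟨x, h⟩

theorem orthogonal_rng (a : H →L[ℂ] H) : (rng a)ᗮ = (star a).ker :=
  ContinuousLinearMap.orthogonal_range a

/-- Self-adjoint idempotents with the same kernel are equal. -/
theorem IsProj.eq_of_apply_eq_zero_iff {s t : H →L[ℂ] H} (hs : IsProj s) (ht : IsProj t)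
    (h : ∀ x, s x = 0 ↔ t x = 0) : s = t := by
  have hts : t * s = t := by
    ext x
    have : t (x - s x) = 0 := (h _).1 (by simp [hs.apply_apply])
    rw [map_sub, sub_eq_zero] at this
    exact this.symm
  have hst : s * t = s := by
    ext x
    have : s (x - t x) = 0 := (h _).2 (by simp [ht.apply_apply])
    rw [map_sub, sub_eq_zero] at this
    exact this.symm
  calc s = star (s * t) := by rw [hst, hs.2.star_eq]
    _ = t := by rw [star_mul, hs.2.star_eq, ht.2.star_eq, hts]

end Paper

/-- For any two projections `p` and `q` on a Hilbert space `H`, the (orthogonal) projection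
onto the closure of the subspace `pqH` equals `p − p ∧ (1−q)`. -/
theorem proj_closure_pq_eq {H : Type} [NormedAddCommGroup H] [InnerProductSpace ℂ H]
    [CompleteSpace H] (p q r s : H →L[ℂ] H)
    (hp : Paper.IsProj p) (hq : Paper.IsProj q)
    (hr : Paper.IsMeetOf r p (1 - q))
    (hs : Paper.IsProj s)
    (hrange : Paper.rng s = (Paper.rng (p * q)).topologicalClosure) :
    s = p - r := by
  have hr_mem (x : H) : r x = x ↔ p x = x ∧ q x = 0 := by
    rw [← hr.1.mem_rng_iff, hr.2, Submodule.mem_inf, hp.mem_rng_iff, hq.one_sub.mem_rng_iff]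
    simp
  have hpr : p * r = r := by
    ext x
    exact ((hr_mem _).1 (hr.1.apply_apply x)).1
  have hqr (x : H) : q (r x) = 0 := ((hr_mem _).1 (hr.1.apply_apply x)).2
  have hrp : r * p = r := by
    simpa [hp.2.star_eq, hr.1.2.star_eq] using congrArg star hpr
  have hpr_proj : Paper.IsProj (p - r) := by
    refine ⟨?_, hp.2.sub hr.1.2⟩
    rw [IsIdempotentElem, sub_mul, mul_sub, mul_sub, hp.1.eq, hpr, hrp, hr.1.1.eq, sub_self,
      sub_zero]
  refine hs.eq_of_apply_eq_zero_iff hpr_proj fun x => ?_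
  have hker : s.ker = (q * p).ker := by
    have h := congrArg Submodule.orthogonal hrange
    rwa [Submodule.orthogonal_closure, Paper.orthogonal_rng, Paper.orthogonal_rng, star_mul,
      hs.2.star_eq, hp.2.star_eq, hq.2.star_eq] at h
  have hsx : s x = 0 ↔ q (p x) = 0 := SetLike.ext_iff.1 hker x
  rw [hsx, sub_apply, sub_eq_zero]
  constructor
  · intro h
    exact ((hr_mem (p x)).2 ⟨hp.apply_apply x, h⟩).symm.trans (DFunLike.congr_fun hrp x)
  · intro h
    rw [h, hqr]
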